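/- Let K and C be convex bodies in ℝ^n containing the origin in their interiors with rC ⊂ K for some r > 0, and for t ∈ (−r, r) let K_t = {x ∈ ℝ^n : ⟨x,u⟩ ≤ h_K(u) + t h_C(u) for all u ∈ S^{n-1}} be the Wulff shape, with support function h_t. Then for any u ∈ S^{n-1}: (i) if K ⊂ RB^n for R > 0 and t ∈ (−r, r), then |h_t(u) − h_K(u)| ≤ (R/r)|t|; (ii) if u is the exterior normal at a smooth boundary point z ∈ ∂K, then lim_{t→0} (h_t(u) − h_K(u))/t = h_C(u). -/

import Mathlib

open MeasureTheory Metric Set Filter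
open scoped ENNReal RealInnerProductSpace NNReal Pointwise

noncomputable section

abbrev Eu (n : ℕ) : Type := EuclideanSpace ℝ (Fin n)

def IsConvexBody {n : ℕ} (K : Set (Eu n)) : Prop :=
  Convex ℝ K ∧ IsCompact K ∧ (interior K).Nonempty

def suppFn {n : ℕ} (K : Set (Eu n)) (u : Eu n) : ℝ :=
  sSup ((fun x => ⟪x, u⟫) '' K)

def IsOuterNormal {n : ℕ} (K : Set (Eu n)) (x u : Eu n) : Prop :=
  ‖u‖ = 1 ∧ ∀ y ∈ K, ⟪y, u⟫ ≤ ⟪x, u⟫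

def gaussMap {n : ℕ} (K : Set (Eu n)) (x : Eu n) : Eu n :=
  open scoped Classical in
  if h : ∃ u, IsOuterNormal K x u then h.choose else 0

def lpSurf {n : ℕ} (p : ℝ) (K : Set (Eu n)) (ω : Set (Eu n)) : ℝ≥0∞ :=
  ∫⁻ x in {x ∈ frontier K | gaussMap K x ∈ ω},
    ENNReal.ofReal (⟪x, gaussMap K x⟫ ^ (1 - p)) ∂(μH[(n:ℝ) - 1])


theorem inner_le_suppFn {n : ℕ} {K : Set (Eu n)} (hK : IsCompact K) {x : Eu n} (hx : x ∈ K)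
    (u : Eu n) : ⟪x, u⟫ ≤ suppFn K u :=
  le_csSup (hK.image (by fun_prop)).bddAbove (mem_image_of_mem _ hx)

theorem suppFn_le {n : ℕ} {K : Set (Eu n)} (hK : K.Nonempty) {u : Eu n} {a : ℝ}
    (h : ∀ x ∈ K, ⟪x, u⟫ ≤ a) : suppFn K u ≤ a :=
  csSup_le (hK.image _) (forall_mem_image.2 h)

theorem continuous_suppFn {n : ℕ} {K : Set (Eu n)} (hK : IsCompact K) :
    Continuous (suppFn K) :=
  hK.continuous_sSup (f := fun u x : Eu n => ⟪x, u⟫)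
    (show Continuous fun p : Eu n × Eu n => ⟪p.2, p.1⟫ by fun_prop)

theorem IsOuterNormal.inner_eq_suppFn {n : ℕ} {K : Set (Eu n)} (hK : IsCompact K) {x u : Eu n}
    (hx : x ∈ K) (h : IsOuterNormal K x u) : ⟪x, u⟫ = suppFn K u :=
  (inner_le_suppFn hK hx u).antisymm (suppFn_le ⟨x, hx⟩ h.2)

theorem mul_suppFn_le_of_smul_subset {n : ℕ} {K C : Set (Eu n)} (hK : IsCompact K)
    (hC : C.Nonempty) {r : ℝ} (hr : 0 < r) (hrC : r • C ⊆ K) (u : Eu n) :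
    r * suppFn C u ≤ suppFn K u := by
  rw [← le_div_iff₀' hr]
  refine suppFn_le hC fun x hx => ?_
  rw [le_div_iff₀' hr, ← real_inner_smul_left]
  exact inner_le_suppFn hK (hrC (smul_mem_smul_set hx)) u

/-- On a compact set, a small positive multiple of `g` is dominated by the nonnegative function
`f` as soon as `f` is positive wherever `g` is nonnegative. -/
theorem IsCompact.eventually_forall_mul_le {X : Type*} [TopologicalSpace X] {S : Set X}
    (hS : IsCompact S) {f g : X → ℝ} (hf : Continuous f) (hg : Continuous g)
    (hf0 : ∀ v ∈ S, 0 ≤ f v) (hpos : ∀ v ∈ S, 0 ≤ g v → 0 < f v) :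
    ∀ᶠ s in nhdsWithin (0 : ℝ) (Ioi 0), ∀ v ∈ S, s * g v ≤ f v := by
  have hA : IsCompact (S ∩ {v | 0 ≤ g v}) := hS.inter_right (isClosed_le continuous_const hg)
  rcases (S ∩ {v | 0 ≤ g v}).eq_empty_or_nonempty with hne | hne
  · filter_upwards [self_mem_nhdsWithin] with s hs v hv
    have hgv : g v < 0 := by
      by_contra! h
      exact (hne ▸ (⟨hv, h⟩ : v ∈ S ∩ {v | 0 ≤ g v}) : v ∈ (∅ : Set X))
    exact (mul_nonpos_of_nonneg_of_nonpos (le_of_lt hs) hgv.le).trans (hf0 v hv)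
  · obtain ⟨a, ha, hmin⟩ := hA.exists_isMinOn hne hf.continuousOn
    obtain ⟨b, hb, hmax⟩ := hA.exists_isMaxOn hne hg.continuousOn
    have hfa : 0 < f a := hpos a ha.1 ha.2
    have hsmall : ∀ᶠ s in nhdsWithin (0 : ℝ) (Ioi 0), s * g b < f a := by
      refine (Continuous.tendsto' (f := fun s : ℝ => s * g b) (by fun_prop) 0 0
        (by simp)).mono_left nhdsWithin_le_nhds |>.eventually_lt_const hfa
    filter_upwards [self_mem_nhdsWithin, hsmall] with s hs hsb v hv
    rcases lt_or_ge (g v) 0 with hgv | hgv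
    · exact (mul_nonpos_of_nonneg_of_nonpos (le_of_lt hs) hgv.le).trans (hf0 v hv)
    · calc s * g v ≤ s * g b := mul_le_mul_of_nonneg_left (hmax ⟨hv, hgv⟩) (le_of_lt hs)
        _ ≤ f a := hsb.le
        _ ≤ f v := hmin ⟨hv, hgv⟩

/-- The Wulff shape of `h_K + t h_C`. -/
def wulffShape {n : ℕ} (K C : Set (Eu n)) (t : ℝ) : Set (Eu n) :=
  {x : Eu n | ∀ u ∈ sphere (0 : Eu n) 1, ⟪x, u⟫ ≤ suppFn K u + t * suppFn C u}

section wulffShape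

variable {n : ℕ} {K C : Set (Eu n)} {t : ℝ} {u : Eu n}

theorem inner_le_suppFn_wulffShape {x : Eu n} (hx : x ∈ wulffShape K C t)
    (hu : u ∈ sphere (0 : Eu n) 1) : ⟪x, u⟫ ≤ suppFn (wulffShape K C t) u :=
  le_csSup ⟨_, forall_mem_image.2 fun _ hy => hy u hu⟩ (mem_image_of_mem _ hx)

theorem suppFn_wulffShape_le (hne : (wulffShape K C t).Nonempty)
    (hu : u ∈ sphere (0 : Eu n) 1) :
    suppFn (wulffShape K C t) u ≤ suppFn K u + t * suppFn C u :=
  suppFn_le hne fun _ hx => hx u hu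

theorem add_smul_mem_wulffShape (hK : IsCompact K) (hC : IsCompact C) (ht : 0 ≤ t) {x y : Eu n}
    (hx : x ∈ K) (hy : y ∈ C) : x + t • y ∈ wulffShape K C t := fun v _ => by
  rw [inner_add_left, real_inner_smul_left]
  exact add_le_add (inner_le_suppFn hK hx v)
    (mul_le_mul_of_nonneg_left (inner_le_suppFn hC hy v) ht)

theorem suppFn_wulffShape_of_nonneg (hK : IsCompact K) (hC : IsCompact C) (hK0 : K.Nonempty)
    (hC0 : C.Nonempty) (ht : 0 ≤ t) (hu : u ∈ sphere (0 : Eu n) 1) :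
    suppFn (wulffShape K C t) u = suppFn K u + t * suppFn C u := by
  obtain ⟨x, hx, hxu⟩ := hK.exists_isMaxOn hK0 (f := fun x => ⟪x, u⟫) (by fun_prop)
  obtain ⟨y, hy, hyu⟩ := hC.exists_isMaxOn hC0 (f := fun x => ⟪x, u⟫) (by fun_prop)
  have hmem := add_smul_mem_wulffShape hK hC ht hx hy
  refine (suppFn_wulffShape_le ⟨_, hmem⟩ hu).antisymm ?_
  have h := inner_le_suppFn_wulffShape hmem hu
  rw [inner_add_left, real_inner_smul_left] at h
  exact (add_le_add (suppFn_le hK0 hxu)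
    (mul_le_mul_of_nonneg_left (suppFn_le hC0 hyu) ht)).trans h

theorem smul_mem_wulffShape (hK : IsCompact K) (hC0 : C.Nonempty) {r : ℝ}
    (hr : 0 < r) (hrC : r • C ⊆ K) (htr : -r ≤ t) (ht : t ≤ 0) {x : Eu n} (hx : x ∈ K) :
    (1 + t / r) • x ∈ wulffShape K C t := fun v _ => by
  have hc : 0 ≤ 1 + t / r := by
    have : -1 ≤ t / r := by rw [le_div_iff₀ hr]; linarith
    linarith
  have h1 := mul_le_mul_of_nonneg_left (inner_le_suppFn hK hx v) hc
  have h2 := mul_le_mul_of_nonpos_left (mul_suppFn_le_of_smul_subset hK hC0 hr hrC v)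
    (div_nonpos_of_nonpos_of_nonneg ht hr.le)
  have h3 : t / r * (r * suppFn C v) = t * suppFn C v := by field_simp
  rw [real_inner_smul_left]
  linarith

theorem abs_suppFn_wulffShape_sub_le (hK : IsCompact K) (hC : IsCompact C) (h0K : 0 ∈ K)
    (h0C : 0 ∈ C) {r : ℝ} (hr : 0 < r) (hrC : r • C ⊆ K) {R : ℝ}
    (hR : K ⊆ closedBall (0 : Eu n) R) (htr : -r ≤ t) (hu : u ∈ sphere (0 : Eu n) 1) :
    |suppFn (wulffShape K C t) u - suppFn K u| ≤ R / r * |t| := by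
  have hu1 : ‖u‖ = 1 := by simpa using hu
  have hKR : suppFn K u ≤ R := suppFn_le ⟨0, h0K⟩ fun x hx => by
    have h1 := real_inner_le_norm x u
    have h2 : ‖x‖ ≤ R := by simpa using hR hx
    rw [hu1] at h1
    linarith
  have hC0 : 0 ≤ suppFn C u := by simpa using inner_le_suppFn hC h0C u
  have hrCK := mul_suppFn_le_of_smul_subset hK ⟨0, h0C⟩ hr hrC u
  have hCR : suppFn C u ≤ R / r := by rw [le_div_iff₀' hr]; linarith
  rcases le_total 0 t with ht | ht
  · rw [suppFn_wulffShape_of_nonneg hK hC ⟨0, h0K⟩ ⟨0, h0C⟩ ht hu, add_sub_cancel_left,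
      abs_of_nonneg (mul_nonneg ht hC0), abs_of_nonneg ht, mul_comm]
    exact mul_le_mul_of_nonneg_right hCR ht
  · obtain ⟨x, hx, hxu⟩ := hK.exists_isMaxOn ⟨0, h0K⟩ (f := fun x => ⟪x, u⟫) (by fun_prop)
    have hmem := smul_mem_wulffShape hK ⟨0, h0C⟩ hr hrC htr ht hx
    have hup := suppFn_wulffShape_le ⟨_, hmem⟩ hu
    have hlow := inner_le_suppFn_wulffShape hmem hu
    rw [real_inner_smul_left] at hlow
    have hxK : ⟪x, u⟫ = suppFn K u :=
      (inner_le_suppFn hK hx u).antisymm (suppFn_le ⟨0, h0K⟩ hxu)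
    rw [hxK] at hlow
    have hneg : t * suppFn C u ≤ 0 := mul_nonpos_of_nonpos_of_nonneg ht hC0
    have h := mul_le_mul_of_nonpos_left hKR (div_nonpos_of_nonpos_of_nonneg ht hr.le)
    have hcomm : R / r * t = t / r * R := by ring
    rw [abs_of_nonpos (by linarith), abs_of_nonpos ht, mul_neg, hcomm]
    linarith

theorem eventually_sub_smul_mem_wulffShape (hK : IsCompact K) (hC : IsCompact C) {z : Eu n}
    (hz : z ∈ K) (hu : IsOuterNormal K z u) (huniq : ∀ u', IsOuterNormal K z u' → u' = u)
    {a : ℝ} (ha : suppFn C u < a) :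
    ∀ᶠ s in nhdsWithin (0 : ℝ) (Ioi 0), z - (s * a) • u ∈ wulffShape K C (-s) := by
  have huu : ⟪u, u⟫ = 1 := by rw [real_inner_self_eq_norm_sq, hu.1, one_pow]
  have hcK := continuous_suppFn hK
  have hcC := continuous_suppFn hC
  have key := (isCompact_sphere (0 : Eu n) 1).eventually_forall_mul_le
    (f := fun v => suppFn K v - ⟪z, v⟫) (g := fun v => suppFn C v - a * ⟪u, v⟫)
    (by fun_prop) (by fun_prop) (fun v _ => sub_nonneg.2 (inner_le_suppFn hK hz v))
    (fun v hv hg => by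
      by_contra! hle
      have hvu : v = u := huniq v ⟨by simpa using hv, fun y hy =>
        (inner_le_suppFn hK hy v).trans (sub_nonpos.1 hle)⟩
      rw [hvu, huu] at hg
      linarith)
  filter_upwards [key] with s hs v hv
  have h := hs v hv
  rw [inner_sub_left, real_inner_smul_left]
  linarith

theorem tendsto_suppFn_wulffShape_sub_div (hK : IsCompact K) (hC : IsCompact C)
    (hC0 : C.Nonempty) {z : Eu n} (hz : z ∈ K) (hu : IsOuterNormal K z u)
    (huniq : ∀ u', IsOuterNormal K z u' → u' = u) :
    Tendsto (fun t : ℝ => (suppFn (wulffShape K C t) u - suppFn K u) / t)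
      (nhdsWithin 0 {(0 : ℝ)}ᶜ) (nhds (suppFn C u)) := by
  have hus : u ∈ sphere (0 : Eu n) 1 := by simpa using hu.1
  have huu : ⟪u, u⟫ = 1 := by rw [real_inner_self_eq_norm_sq, hu.1, one_pow]
  have hev : ∀ a, suppFn C u < a → ∀ᶠ t in nhdsWithin (0 : ℝ) (Iio 0),
      suppFn C u ≤ (suppFn (wulffShape K C t) u - suppFn K u) / t ∧
        (suppFn (wulffShape K C t) u - suppFn K u) / t ≤ a := by
    intro a ha
    have hneg : Tendsto (fun t : ℝ => -t) (nhdsWithin 0 (Iio 0)) (nhdsWithin 0 (Ioi 0)) := by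
      simpa using tendsto_neg_nhdsLT (a := (0 : ℝ))
    filter_upwards [self_mem_nhdsWithin,
      hneg.eventually (eventually_sub_smul_mem_wulffShape hK hC hz hu huniq ha)] with t ht hmem
    rw [neg_neg] at hmem
    have hup := suppFn_wulffShape_le ⟨_, hmem⟩ hus
    have hlow := inner_le_suppFn_wulffShape hmem hus
    rw [inner_sub_left, real_inner_smul_left, huu, hu.inner_eq_suppFn hK hz] at hlow
    rw [le_div_iff_of_neg ht, div_le_iff_of_neg ht]
    constructor <;> linarith
  rw [← Iio_union_Ioi, nhdsWithin_union, tendsto_sup]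
  constructor
  · refine tendsto_order.2 ⟨fun b hb => ?_, fun b hb => ?_⟩
    · filter_upwards [hev _ (lt_add_one _)] with t ht using hb.trans_le ht.1
    · obtain ⟨a, ha, hab⟩ := exists_between hb
      filter_upwards [hev a ha] with t ht using ht.2.trans_lt hab
  · refine tendsto_const_nhds.congr' ?_
    filter_upwards [self_mem_nhdsWithin] with t ht
    rw [suppFn_wulffShape_of_nonneg hK hC ⟨z, hz⟩ hC0 (le_of_lt ht) hus, add_sub_cancel_left,
      mul_div_cancel_left₀ _ (ne_of_gt ht)]

end wulffShape

/-- Lemma 2.3: for convex bodies `K, C` with the origin interior and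
`rC ⊆ K`, and the Wulff shapes `K_t = {x : ⟨x,u⟩ ≤ h_K(u) + t h_C(u) ∀ u ∈ S^{n-1}}`:
(i) if `K ⊆ RBⁿ` then `|h_t(u) - h_K(u)| ≤ (R/r)|t|` for `t ∈ (-r,r)`;
(ii) if `u` is the exterior normal at a smooth point `z ∈ ∂K`, then
`lim_{t→0} (h_t(u) - h_K(u))/t = h_C(u)`. -/
theorem wulff_shape_variation
    (n : ℕ) (K C : Set (Eu n)) (hK : IsConvexBody K) (hC : IsConvexBody C)
    (h0K : (0 : Eu n) ∈ interior K) (h0C : (0 : Eu n) ∈ interior C)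
    (r : ℝ) (hr : 0 < r) (hrC : r • C ⊆ K)
    (Kt : ℝ → Set (Eu n))
    (hKt : ∀ t, Kt t = {x : Eu n | ∀ u ∈ sphere (0 : Eu n) 1,
      ⟪x, u⟫ ≤ suppFn K u + t * suppFn C u}) :
    (∀ R : ℝ, 0 < R → K ⊆ closedBall (0 : Eu n) R →
      ∀ t ∈ Set.Ioo (-r) r, ∀ u ∈ sphere (0 : Eu n) 1,
        |suppFn (Kt t) u - suppFn K u| ≤ (R / r) * |t|) ∧
    (∀ z u : Eu n, z ∈ frontier K → IsOuterNormal K z u →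
      (∀ u', IsOuterNormal K z u' → u' = u) →
      Filter.Tendsto (fun t : ℝ => (suppFn (Kt t) u - suppFn K u) / t)
        (nhdsWithin 0 {(0:ℝ)}ᶜ) (nhds (suppFn C u))) := by
  obtain rfl : Kt = wulffShape K C := funext hKt
  have h0K' := interior_subset h0K
  have h0C' := interior_subset h0C
  refine ⟨fun R _ hR t ht u hu =>
    abs_suppFn_wulffShape_sub_le hK.2.1 hC.2.1 h0K' h0C' hr hrC hR ht.1.le hu,
    fun z u hz hu huniq => ?_⟩
  exact tendsto_suppFn_wulffShape_sub_div hK.2.1 hC.2.1 ⟨0, h0C'⟩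
    (hK.2.1.isClosed.frontier_subset hz) hu huniq

end
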